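/- arXiv:2010.04378 — 12 statements merged into one kernel-verified Lean document; each statement's English description precedes it below -/
import Mathlib

section
/- Let a, b, c > 0, τ ∈ ℕ with τ ≥ 1, and let (z_t)_{t≥0} be a solution of the delay recurrence z_{t+1} = H(z_t, z_{t−τ+1}) (for t ≥ τ−1) with nonnegative initial conditions z_0, …, z_{τ−1} ≥ 0. If z_i = 0 for all i ∈ {0, …, τ−1}, then z_t = 0 for all t ≥ 0. If instead z_s > 0 for at least one s ∈ {0, …, τ−1}, then z_t > 0 for all t ≥ τ + s. -/
/-- `Hfun a b c β u v = (1/m(u)) * (u + a·b·v/M(v))` where `m(x) = 1+b+cx` and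
`M(x) = bβ + (β-1)cx`. -/
noncomputable def Hfun (a b c β u v : ℝ) : ℝ :=
  (1 / (1 + b + c * u)) * (u + a * b * v / (b * β + (β - 1) * c * v))

/-- Positivity of solutions of the delayed Beverton–Holt recurrence
`z_{t+1} = H(z_t, z_{t-τ+1})` (written here as `z_{t+τ} = H(z_{t+τ-1}, z_t)`). -/
theorem stmt0 (a b c : ℝ) (ha : 0 < a) (hb : 0 < b) (hc : 0 < c)
    (τ : ℕ) (hτ : 1 ≤ τ) (z : ℕ → ℝ)
    (hinit : ∀ i, i < τ → 0 ≤ z i)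
    (hrec : ∀ t, z (t + τ) = Hfun a b c ((1 + b) ^ τ) (z (t + τ - 1)) (z t)) :
    ((∀ i, i < τ → z i = 0) → ∀ t, z t = 0) ∧
    (∀ s, s < τ → 0 < z s → ∀ t, τ + s ≤ t → 0 < z t) := by
  have hβ : 1 ≤ (1 + b) ^ τ := one_le_pow₀ (by linarith)
  have hM : ∀ v : ℝ, 0 ≤ v → 0 < b * (1 + b) ^ τ + ((1 + b) ^ τ - 1) * c * v := by
    intro v hv
    have h1 : 0 < b * (1 + b) ^ τ := by positivity
    have h2 : 0 ≤ ((1 + b) ^ τ - 1) * c * v :=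
      mul_nonneg (mul_nonneg (by linarith) hc.le) hv
    linarith
  have hnn : ∀ u v : ℝ, 0 ≤ u → 0 ≤ v → 0 ≤ Hfun a b c ((1 + b) ^ τ) u v := by
    intro u v hu hv
    have h := hM v hv
    unfold Hfun
    have h2 : 0 ≤ a * b * v / (b * (1 + b) ^ τ + ((1 + b) ^ τ - 1) * c * v) :=
      div_nonneg (by positivity) h.le
    positivity
  have hpos : ∀ u v : ℝ, 0 ≤ u → 0 ≤ v → (0 < u ∨ 0 < v) →
      0 < Hfun a b c ((1 + b) ^ τ) u v := by
    intro u v hu hv huv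
    have h := hM v hv
    unfold Hfun
    have h2 : 0 ≤ a * b * v / (b * (1 + b) ^ τ + ((1 + b) ^ τ - 1) * c * v) :=
      div_nonneg (by positivity) h.le
    refine mul_pos (by positivity) ?_
    rcases huv with hu' | hv'
    · linarith
    · have h3 : 0 < a * b * v / (b * (1 + b) ^ τ + ((1 + b) ^ τ - 1) * c * v) :=
        div_pos (by positivity) h
      linarith
  have hz : ∀ t, 0 ≤ z t := by
    intro t
    induction t using Nat.strong_induction_on with
    | _ t ih =>
      by_cases ht : t < τ
      · exact hinit t ht
      · obtain ⟨n, rfl⟩ := Nat.exists_eq_add_of_le' (not_lt.mp ht)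
        rw [hrec]
        exact hnn _ _ (ih _ (by omega)) (ih _ (by omega))
  refine ⟨?_, ?_⟩
  · intro h0 t
    induction t using Nat.strong_induction_on with
    | _ t ih =>
      by_cases ht : t < τ
      · exact h0 t ht
      · obtain ⟨n, rfl⟩ := Nat.exists_eq_add_of_le' (not_lt.mp ht)
        rw [hrec, ih (n + τ - 1) (by omega), ih n (by omega)]
        simp [Hfun]
  · intro s _ hs t ht
    induction t, ht using Nat.le_induction with
    | base =>
      rw [add_comm, hrec]
      exact hpos _ _ (hz _) (hz _) (Or.inr hs)
    | succ t ht ih =>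
      obtain ⟨n, hn⟩ := Nat.exists_eq_add_of_le' (show τ ≤ t + 1 by omega)
      rw [hn, hrec]
      refine hpos _ _ (hz _) (hz _) (Or.inl ?_)
      rw [← hn]
      simpa using ih
end

section
/- Let a, b, c > 0 and τ ∈ ℕ with τ ≥ 1, and set β = (1+b)^τ. If a ≤ b·β, then z = 0 is the only nonnegative solution of the equilibrium equation z = H(z, z), i.e., of z = z/(1+b+cz) + (a/(1+b+cz))·(b·z/(bβ + (β−1)cz)). -/
/-- If `a ≤ b·β` (with `β = (1+b)^τ`), then `z = 0` is the only nonnegative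
solution of the equilibrium equation `z = H(z,z)`. -/
theorem stmt1 (a b c : ℝ) (ha : 0 < a) (hb : 0 < b) (hc : 0 < c)
    (τ : ℕ) (hτ : 1 ≤ τ) (hab : a ≤ b * (1 + b) ^ τ) :
    Hfun a b c ((1 + b) ^ τ) 0 0 = 0 ∧
    ∀ z : ℝ, 0 ≤ z → z = Hfun a b c ((1 + b) ^ τ) z z → z = 0 := by
  refine ⟨by simp [Hfun], ?_⟩
  intro z hz h
  by_contra hne
  have hzp : 0 < z := lt_of_le_of_ne hz (Ne.symm hne)
  have hβ : 1 ≤ (1 + b) ^ τ := one_le_pow₀ (by linarith)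
  generalize (1 + b) ^ τ = β at *
  unfold Hfun at h
  have hcz : 0 < c * z := mul_pos hc hzp
  have hm : 0 < 1 + b + c * z := by linarith
  have hM1 : b * β ≤ b * β + (β - 1) * c * z := by
    have : 0 ≤ (β - 1) * (c * z) := mul_nonneg (by linarith) hcz.le
    linarith
  generalize b * β + (β - 1) * c * z = M at *
  have hMa : a ≤ M := hab.trans hM1
  have hM : 0 < M := lt_of_lt_of_le ha hMa
  have h2 : z * ((1 + b + c * z) * M) = z * (M + a * b) := by
    field_simp at h
    linear_combination z * h
  have h3 := mul_left_cancel₀ hne h2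
  have h4 : b * a ≤ b * M := mul_le_mul_of_nonneg_left hMa hb.le
  have h5 : 0 < c * z * M := mul_pos hcz hM
  linarith
end

section
/- Let a, b, c > 0 and τ ∈ ℕ with τ ≥ 1, and set β = (1+b)^τ. If a > b·β, then the equation z = H(z, z) has exactly one positive solution, given by z₊ = (−b(2β−1) + √(b²(2β−1)² + 4b(a−bβ)(β−1)))/(2c(β−1)). -/
/-- The positive equilibrium `z₊` of the delayed Beverton–Holt recurrence. -/
noncomputable def zplus (a b c β : ℝ) : ℝ :=
  (-(b * (2 * β - 1)) +
      Real.sqrt ((b * (2 * β - 1)) ^ 2 + 4 * b * (a - b * β) * (β - 1))) /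
    (2 * c * (β - 1))

theorem Hfun_fix_iff (a b c β z : ℝ) (hb : 0 < b) (hc : 0 < c) (hβ : 1 < β) (hz : 0 < z) :
    z = Hfun a b c β z z ↔
      (β - 1) * (c * z) ^ 2 + b * (2 * β - 1) * (c * z) - b * (a - b * β) = 0 := by
  have hβ' : 0 < β - 1 := by linarith
  have h1 : 0 < 1 + b + c * z := by positivity
  have h2 : 0 < b * β + (β - 1) * c * z := by positivity
  have key : z - Hfun a b c β z z =
      z / ((1 + b + c * z) * (b * β + (β - 1) * c * z)) *
      ((β - 1) * (c * z) ^ 2 + b * (2 * β - 1) * (c * z) - b * (a - b * β)) := by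
    unfold Hfun
    have h1' := h1.ne'
    have h2' := h2.ne'
    rw [div_mul_eq_mul_div z, eq_div_iff (mul_ne_zero h1' h2')]
    have e1 : 1 / (1 + b + c * z) * (1 + b + c * z) = 1 := one_div_mul_cancel h1'
    have e2 : a * b * z / (b * β + (β - 1) * c * z) * (b * β + (β - 1) * c * z) = a * b * z :=
      div_mul_cancel₀ _ h2'
    generalize 1 / (1 + b + c * z) = p at *
    generalize a * b * z / (b * β + (β - 1) * c * z) = q at *
    linear_combination (-(z + q) * (b * β + (β - 1) * c * z)) * e1 - e2
  rw [← sub_eq_zero, key, mul_eq_zero]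
  have : z / ((1 + b + c * z) * (b * β + (β - 1) * c * z)) ≠ 0 := by positivity
  simp [this]

/-- If `a > b·β` (with `β = (1+b)^τ`), then the equation `z = H(z,z)` has exactly
one positive solution, namely `z₊`. -/
theorem stmt2 (a b c : ℝ) (ha : 0 < a) (hb : 0 < b) (hc : 0 < c)
    (τ : ℕ) (hτ : 1 ≤ τ) (hab : b * (1 + b) ^ τ < a) :
    (0 < zplus a b c ((1 + b) ^ τ) ∧
      zplus a b c ((1 + b) ^ τ) =
        Hfun a b c ((1 + b) ^ τ) (zplus a b c ((1 + b) ^ τ))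
          (zplus a b c ((1 + b) ^ τ))) ∧
    ∀ z : ℝ, 0 < z → z = Hfun a b c ((1 + b) ^ τ) z z →
      z = zplus a b c ((1 + b) ^ τ) := by
  have hβ : 1 < (1 + b) ^ τ := one_lt_pow₀ (by linarith) (by omega)
  generalize (1 + b) ^ τ = β at *
  have hβ' : 0 < β - 1 := by linarith
  have hB : 0 < b * (2 * β - 1) := mul_pos hb (by linarith)
  have hC : 0 < b * (a - b * β) := mul_pos hb (by linarith)
  have hD : 0 < 4 * b * (a - b * β) * (β - 1) := by
    have := mul_pos hC hβ'
    linarith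
  have hs := Real.sq_sqrt (add_nonneg (sq_nonneg (b * (2 * β - 1))) hD.le)
  have hlt : b * (2 * β - 1) <
      Real.sqrt ((b * (2 * β - 1)) ^ 2 + 4 * b * (a - b * β) * (β - 1)) :=
    Real.lt_sqrt_of_sq_lt (by linarith)
  have hw : 2 * (β - 1) * (c * zplus a b c β) = -(b * (2 * β - 1)) +
      Real.sqrt ((b * (2 * β - 1)) ^ 2 + 4 * b * (a - b * β) * (β - 1)) := by
    unfold zplus
    field_simp
  have hpos : 0 < zplus a b c β := by
    unfold zplus
    exact div_pos (by linarith) (by positivity)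
  have hq : (β - 1) * (c * zplus a b c β) ^ 2 + b * (2 * β - 1) * (c * zplus a b c β)
      - b * (a - b * β) = 0 := by
    have hw' : Real.sqrt ((b * (2 * β - 1)) ^ 2 + 4 * b * (a - b * β) * (β - 1)) =
        2 * (β - 1) * (c * zplus a b c β) + b * (2 * β - 1) := by linarith
    rw [hw'] at hs
    have : 4 * (β - 1) * ((β - 1) * (c * zplus a b c β) ^ 2
      + b * (2 * β - 1) * (c * zplus a b c β) - b * (a - b * β)) = 0 := by
      linear_combination hs
    exact (mul_eq_zero.mp this).resolve_left (by positivity)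
  refine ⟨⟨hpos, (Hfun_fix_iff a b c β _ hb hc hβ hpos).2 hq⟩, fun z hz h => ?_⟩
  have hz' := (Hfun_fix_iff a b c β z hb hc hβ hz).1 h
  have hp : 0 < c * ((β - 1) * c * (z + zplus a b c β) + b * (2 * β - 1)) := by positivity
  have : (z - zplus a b c β) * (c * ((β - 1) * c * (z + zplus a b c β) + b * (2 * β - 1))) = 0 := by
    linear_combination hz' - hq
  exact sub_eq_zero.mp ((mul_eq_zero.mp this).resolve_right hp.ne')
end

section
/- Let a, b, c > 0 and for each integer τ ≥ 1 with a > b·(1+b)^τ define f(τ) = z₊(τ) = (−b(2β−1) + √(b²(2β−1)² + 4b(a−bβ)(β−1)))/(2c(β−1)), where β = (1+b)^τ. Then f is strictly decreasing in τ (i.e., f(τ+1) < f(τ) whenever both are defined), and f(τ) ≤ (a−b)/c for every such τ. -/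
theorem zplus_spec (a b c β : ℝ) (hb : 0 < b) (hc : 0 < c) (hβ : 1 < β) (h : b * β < a) :
    0 < c * zplus a b c β ∧
    (β - 1) * (c * zplus a b c β) ^ 2 + b * (2 * β - 1) * (c * zplus a b c β)
      = b * (a - b * β) := by
  have hβ' : 0 < β - 1 := by linarith
  have hp : 0 < 4 * b * (a - b * β) * (β - 1) := by
    have : 0 < a - b * β := by linarith
    positivity
  have hq : 0 < b * (2 * β - 1) := mul_pos hb (by linarith)
  set s := Real.sqrt ((b * (2 * β - 1)) ^ 2 + 4 * b * (a - b * β) * (β - 1)) with hs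
  have hs2 : s ^ 2 = (b * (2 * β - 1)) ^ 2 + 4 * b * (a - b * β) * (β - 1) :=
    Real.sq_sqrt (by positivity)
  have hlt : b * (2 * β - 1) < s := Real.lt_sqrt_of_sq_lt (by linarith)
  have hw : c * zplus a b c β = (s - b * (2 * β - 1)) / (2 * (β - 1)) := by
    unfold zplus
    rw [← hs]
    field_simp
    ring
  rw [hw]
  constructor
  · exact div_pos (by linarith) (by linarith)
  · field_simp
    nlinarith [hs2]

/-- The positive equilibrium `f(τ) = z₊(τ)` (defined when `a > b(1+b)^τ`) is
strictly decreasing in the delay `τ`, and is bounded above by `(a-b)/c`. -/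
theorem stmt4 (a b c : ℝ) (ha : 0 < a) (hb : 0 < b) (hc : 0 < c) :
    (∀ τ : ℕ, 1 ≤ τ → b * (1 + b) ^ τ < a → b * (1 + b) ^ (τ + 1) < a →
      zplus a b c ((1 + b) ^ (τ + 1)) < zplus a b c ((1 + b) ^ τ)) ∧
    (∀ τ : ℕ, 1 ≤ τ → b * (1 + b) ^ τ < a →
      zplus a b c ((1 + b) ^ τ) ≤ (a - b) / c) := by
  have hpow : ∀ τ : ℕ, 1 ≤ τ → 1 < (1 + b) ^ τ := fun τ hτ =>
    one_lt_pow₀ (by linarith) (by omega)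
  constructor
  · intro τ hτ h1 h2
    have hβ1 := hpow τ hτ
    have hβ : (1 + b) ^ τ < (1 + b) ^ (τ + 1) := by
      rw [pow_succ]; nlinarith
    obtain ⟨p1, e1⟩ := zplus_spec a b c _ hb hc hβ1 h1
    obtain ⟨p2, e2⟩ := zplus_spec a b c _ hb hc (hβ1.trans hβ) h2
    generalize (1 + b) ^ τ = β at *
    generalize (1 + b) ^ (τ + 1) = γ at *
    by_contra hcon
    have hle : c * zplus a b c β ≤ c * zplus a b c γ :=
      mul_le_mul_of_nonneg_left (not_lt.mp hcon) hc.le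
    generalize c * zplus a b c β = u at *
    generalize c * zplus a b c γ = v at *
    have k1 : (β - 1) * u ^ 2 ≤ (γ - 1) * v ^ 2 := by
      apply mul_le_mul (by linarith) (by gcongr) (by positivity) (by linarith)
    have k2 : b * (2 * β - 1) * u ≤ b * (2 * γ - 1) * v := by
      apply mul_le_mul _ hle p1.le (mul_nonneg hb.le (by linarith))
      exact mul_le_mul_of_nonneg_left (by linarith) hb.le
    nlinarith [mul_pos (mul_pos hb hb) (sub_pos.mpr hβ)]
  · intro τ hτ h1
    have hβ1 := hpow τ hτ
    obtain ⟨p1, e1⟩ := zplus_spec a b c _ hb hc hβ1 h1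
    generalize (1 + b) ^ τ = β at *
    rw [le_div_iff₀ hc, mul_comm]
    generalize c * zplus a b c β = u at *
    have k1 : 0 ≤ (β - 1) * u ^ 2 := mul_nonneg (by linarith) (by positivity)
    have k2 : 0 ≤ b * (β - 1) * u := mul_nonneg (mul_nonneg hb.le (by linarith)) p1.le
    have k3 : 0 ≤ b * (b * (β - 1)) := mul_nonneg hb.le (mul_nonneg hb.le (by linarith))
    refine le_of_mul_le_mul_left ?_ hb
    nlinarith
end

section
/- Let x, y ∈ ℝ and N ∈ ℕ with N ≥ 2, and let A be the N×N real matrix with A_{1,1} = x, A_{1,N} = y, A_{i+1,i} = 1 for i = 1, …, N−1, and all other entries 0. Then A^N is the matrix whose entries are: (A^N)_{1,1} = x^N + y; (A^N)_{1,i} = x^{i−1}·y for 2 ≤ i ≤ N; for rows j with 2 ≤ j ≤ N: (A^N)_{j,1} = x^{N−j+1}, (A^N)_{j,i} = 0 for 2 ≤ i < j, and (A^N)_{j,i} = x^{i−j}·y for j ≤ i ≤ N. -/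
/-- The companion-type matrix with first row `(x, 0, …, 0, y)`, subdiagonal
entries equal to `1`, and all other entries `0` (0-indexed). -/
def compMat (x y : ℝ) (N : ℕ) : Matrix (Fin N) (Fin N) ℝ :=
  Matrix.of fun i j =>
    if (i : ℕ) = 0 ∧ (j : ℕ) = 0 then x
    else if (i : ℕ) = 0 ∧ (j : ℕ) = N - 1 then y
    else if (i : ℕ) = (j : ℕ) + 1 then 1
    else 0

theorem compMat_row_zero (x y : ℝ) (n : ℕ) (v : Fin (n + 2) → ℝ) :
    ∑ l, compMat x y (n + 2) 0 l * v l = x * v 0 + y * v (Fin.last (n + 1)) := by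
  have h : ∀ l : Fin (n + 2), compMat x y (n + 2) 0 l * v l =
      (if l = 0 then x * v l else 0) + (if l = Fin.last (n + 1) then y * v l else 0) := by
    intro l
    simp only [compMat, Matrix.of_apply, Fin.ext_iff, Fin.val_last, Fin.val_zero]
    grind
  simp only [h, Finset.sum_add_distrib, Finset.sum_ite_eq', Finset.mem_univ, if_true]

theorem compMat_row_succ (x y : ℝ) (n : ℕ) (v : Fin (n + 2) → ℝ) (i : Fin (n + 1)) :
    ∑ l, compMat x y (n + 2) i.succ l * v l = v i.castSucc := by
  have h : ∀ l : Fin (n + 2), compMat x y (n + 2) i.succ l * v l =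
      (if l = i.castSucc then v l else 0) := by
    intro l
    simp only [compMat, Matrix.of_apply, Fin.ext_iff, Fin.val_succ, Fin.val_castSucc]
    grind
  simp only [h, Finset.sum_ite_eq', Finset.mem_univ, if_true]

/-- Entry `(i, j)` of the `k`-th power, for `k ≤ n + 2`. -/
def powEntry (x y : ℝ) (n k i j : ℕ) : ℝ :=
  if k ≤ i then (if j + k = i then 1 else 0)
  else if j = 0 then x ^ (k - i) + (if k - i = n + 2 then y else 0)
  else if n + 2 ≤ (k - i) + j then x ^ ((k - i) + j - (n + 2)) * y else 0

theorem compMat_pow (x y : ℝ) (n k : ℕ) (hk : k ≤ n + 2) (i j : Fin (n + 2)) :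
    (compMat x y (n + 2) ^ k) i j =
      powEntry x y n k i j := by
  induction k generalizing i with
  | zero => simp [powEntry, Matrix.one_apply, Fin.ext_iff, eq_comm]
  | succ k ih =>
    have ih := fun i => ih (by omega) i
    have hj := j.isLt
    rw [pow_succ', Matrix.mul_apply]
    refine Fin.cases ?_ (fun i => ?_) i
    · rw [compMat_row_zero x y n (fun l => (compMat x y (n + 2) ^ k) l j)]
      simp only [ih, Fin.val_zero, Fin.val_last]
      unfold powEntry
      simp only [Nat.sub_zero]
      rw [if_pos (show k ≤ n + 1 by omega), if_neg (show ¬ (k + 1 ≤ 0) by omega)]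
      by_cases hj0 : (j : ℕ) = 0
      · rcases Nat.eq_zero_or_pos k with rfl | hk0
        · simp [hj0]
        · have h1 : ¬ k ≤ 0 := by omega
          have h2 : k ≠ n + 2 := by omega
          simp [hj0, h1, h2, pow_succ']
      · rcases Nat.eq_zero_or_pos k with rfl | hk0
        · by_cases h : (j : ℕ) = n + 1
          · simp [h, show 1 + (n + 1) - (n + 2) = 0 by omega, show n + 2 ≤ 1 + (n + 1) by omega]
          · simp [hj0, h, show ¬ n + 2 ≤ 1 + (j : ℕ) by omega]
        · have h1 : ¬ k ≤ 0 := by omega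
          rw [if_neg h1, if_neg hj0, if_neg hj0]
          rcases lt_trichotomy (k + 1 + (j : ℕ)) (n + 2) with h | h | h
          · rw [if_neg (by omega), if_neg (by omega), if_neg (by omega)]; ring
          · rw [if_neg (by omega), if_pos (by omega), if_pos (by omega), h]; simp
          · rw [if_pos (by omega), if_neg (by omega), if_pos (by omega),
              show k + 1 + (j : ℕ) - (n + 2) = (k + j - (n + 2)) + 1 by omega]
            ring
    · rw [compMat_row_succ x y n (fun l => (compMat x y (n + 2) ^ k) l j)]
      simp only [ih, Fin.val_succ, Fin.val_castSucc, powEntry, Nat.add_sub_add_right,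
        Nat.add_le_add_iff_right, ← Nat.add_assoc, Nat.add_right_cancel_iff]

/-- Explicit form of the `N`-th power of the companion-type matrix `A`:
(in 0-indexed form) `(A^N)_{0,0} = x^N + y`, `(A^N)_{0,j} = x^j y` for `j ≥ 1`;
for rows `i ≥ 1`: `(A^N)_{i,0} = x^{N-i}`, `(A^N)_{i,j} = 0` for `1 ≤ j < i`,
and `(A^N)_{i,j} = x^{j-i} y` for `j ≥ i`. -/
theorem stmt5 (x y : ℝ) (N : ℕ) (hN : 2 ≤ N) :
    ∀ i j : Fin N,
      (compMat x y N ^ N) i j =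
        if (i : ℕ) = 0 ∧ (j : ℕ) = 0 then x ^ N + y
        else if (i : ℕ) = 0 then x ^ (j : ℕ) * y
        else if (j : ℕ) = 0 then x ^ (N - (i : ℕ))
        else if (j : ℕ) < (i : ℕ) then 0
        else x ^ ((j : ℕ) - (i : ℕ)) * y := by
  obtain ⟨n, rfl⟩ : ∃ n, N = n + 2 := ⟨N - 2, by omega⟩
  intro i j
  have hi := i.isLt
  have hj := j.isLt
  rw [compMat_pow x y n _ le_rfl, powEntry, if_neg (by omega)]
  by_cases hi0 : (i : ℕ) = 0
  · by_cases hj0 : (j : ℕ) = 0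
    · simp [hi0, hj0]
    · simp [hi0, hj0]
  · by_cases hj0 : (j : ℕ) = 0
    · rw [if_pos hj0, if_neg (by omega), if_neg (by omega), if_neg hi0, if_pos hj0, add_zero]
    · rw [if_neg hj0, if_neg (show ¬ ((i : ℕ) = 0 ∧ (j : ℕ) = 0) from fun h => hi0 h.1), if_neg hi0,
        if_neg hj0]
      by_cases h : (j : ℕ) < i
      · rw [if_neg (show ¬ n + 2 ≤ n + 2 - (i : ℕ) + j by omega), if_pos h]
      · rw [if_pos (show n + 2 ≤ n + 2 - (i : ℕ) + j by omega), if_neg h,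
          show n + 2 - (i : ℕ) + j - (n + 2) = (j : ℕ) - i by omega]
end

section
/- Let x, y ∈ ℝ with |x| + |y| < 1, let N ∈ ℕ with N ≥ 2, and let A be the N×N real matrix with A_{1,1} = x, A_{1,N} = y, A_{i+1,i} = 1 for i = 1, …, N−1, and all other entries 0. Then the absolute row sums of A^N are nondecreasing in the row index, i.e., Σ_{i=1}^N |(A^N)_{k,i}| ≤ Σ_{i=1}^N |(A^N)_{j,i}| for 1 ≤ k < j ≤ N, and the maximum absolute row sum (the ∞-operator norm of A^N) equals the absolute row sum of the last row, which is |x| + |y| < 1. -/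
lemma row0_sum (x y : ℝ) (N : ℕ) (hN : 2 ≤ N) :
    ∑ j, |compMat x y N ⟨0, by omega⟩ j| = |x| + |y| := by
  rw [← Finset.sum_subset (Finset.subset_univ
    ({⟨0, by omega⟩, ⟨N - 1, by omega⟩} : Finset (Fin N)))]
  · rw [Finset.sum_pair (by simp [Fin.ext_iff]; omega)]
    have : N - 1 ≠ 0 := by omega
    simp [compMat, this]
  · intro j _ hj
    simp [Fin.ext_iff] at hj
    simp [compMat, hj]

lemma row_succ (x y : ℝ) (N : ℕ) (k : ℕ) (hk : k + 1 < N) (j : Fin N) :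
    compMat x y N ⟨k + 1, hk⟩ j = if (⟨k, by omega⟩ : Fin N) = j then 1 else 0 := by
  simp [compMat, Fin.ext_iff]

lemma row_le_one (x y : ℝ) (N : ℕ) (hN : 2 ≤ N) (hxy : |x| + |y| < 1) (i : Fin N) :
    ∑ j, |compMat x y N i j| ≤ 1 := by
  obtain ⟨i, hi⟩ := i
  cases i with
  | zero => rw [row0_sum x y N hN]; exact hxy.le
  | succ k =>
    simp only [row_succ, apply_ite abs, abs_one, abs_zero]
    simp

lemma mul_row_succ (x y : ℝ) (N : ℕ) (B : Matrix (Fin N) (Fin N) ℝ)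
    (k : ℕ) (hk : k + 1 < N) (j : Fin N) :
    (compMat x y N * B) ⟨k + 1, hk⟩ j = B ⟨k, by omega⟩ j := by
  simp [Matrix.mul_apply, row_succ]

lemma mul_row_le (x y : ℝ) (N : ℕ) (hN : 2 ≤ N) (hxy : |x| + |y| < 1)
    (B : Matrix (Fin N) (Fin N) ℝ) (k : Fin N) :
    ∑ j, |(B * compMat x y N) k j| ≤ ∑ i, |B k i| := by
  calc ∑ j, |(B * compMat x y N) k j|
      ≤ ∑ j, ∑ i, |B k i| * |compMat x y N i j| := by
        refine Finset.sum_le_sum fun j _ => ?_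
        rw [Matrix.mul_apply]
        refine (Finset.abs_sum_le_sum_abs _ _).trans_eq ?_
        simp [abs_mul]
    _ = ∑ i, |B k i| * ∑ j, |compMat x y N i j| := by
        rw [Finset.sum_comm]
        simp [Finset.mul_sum]
    _ ≤ ∑ i, |B k i| := by
        refine Finset.sum_le_sum fun i _ => ?_
        exact mul_le_of_le_one_right (abs_nonneg _) (row_le_one x y N hN hxy i)

lemma pow_row (x y : ℝ) (N : ℕ) (m : ℕ) (hm : m < N) (j : Fin N) :
    (compMat x y N ^ (m + 1)) ⟨m, hm⟩ j = compMat x y N ⟨0, by omega⟩ j := by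
  induction m with
  | zero => simp
  | succ m ih => rw [pow_succ', mul_row_succ, ih]

lemma step_le (x y : ℝ) (N : ℕ) (hN : 2 ≤ N) (hxy : |x| + |y| < 1) (k : ℕ) (hk : k + 1 < N) :
    ∑ i, |(compMat x y N ^ N) ⟨k, by omega⟩ i| ≤ ∑ i, |(compMat x y N ^ N) ⟨k + 1, hk⟩ i| := by
  obtain ⟨M, rfl⟩ : ∃ M, N = M + 1 := ⟨N - 1, by omega⟩
  have h : ∀ i, (compMat x y (M + 1) ^ (M + 1)) ⟨k + 1, hk⟩ i
      = (compMat x y (M + 1) ^ M) ⟨k, by omega⟩ i := fun i => by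
    rw [pow_succ', mul_row_succ]
  simp only [h]
  rw [pow_succ]
  exact mul_row_le x y _ hN hxy _ _

lemma mono_le (x y : ℝ) (N : ℕ) (hN : 2 ≤ N) (hxy : |x| + |y| < 1) (k : ℕ) (hk : k < N)
    (j : ℕ) (hkj : k ≤ j) (hj : j < N) :
    ∑ i, |(compMat x y N ^ N) ⟨k, hk⟩ i| ≤ ∑ i, |(compMat x y N ^ N) ⟨j, hj⟩ i| := by
  induction j, hkj using Nat.le_induction with
  | base => exact le_rfl
  | succ j _ ih => exact (ih (by omega)).trans (step_le x y N hN hxy j hj)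

/-- If `|x| + |y| < 1`, the absolute row sums of `A^N` are nondecreasing in the
row index, every row sum is at most `|x| + |y|`, and the last row sum (which is
the maximum absolute row sum, i.e. the ∞-operator norm of `A^N`) equals
`|x| + |y| < 1`. -/
theorem stmt6 (x y : ℝ) (N : ℕ) (hN : 2 ≤ N) (hxy : |x| + |y| < 1) :
    (∀ k j : Fin N, (k : ℕ) < (j : ℕ) →
      ∑ i, |(compMat x y N ^ N) k i| ≤ ∑ i, |(compMat x y N ^ N) j i|) ∧
    (∀ j : Fin N, ∑ i, |(compMat x y N ^ N) j i| ≤ |x| + |y|) ∧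
    (∑ i, |(compMat x y N ^ N) (⟨N - 1, by omega⟩ : Fin N) i| = |x| + |y|) := by
  have hlast : ∑ i, |(compMat x y N ^ N) (⟨N - 1, by omega⟩ : Fin N) i| = |x| + |y| := by
    rw [← row0_sum x y N hN]
    refine Finset.sum_congr rfl fun i _ => ?_
    have h := pow_row x y N (N - 1) (by omega) i
    rw [Nat.sub_add_cancel (by omega)] at h
    rw [h]
  refine ⟨fun k j hkj => mono_le x y N hN hxy k k.2 j hkj.le j.2, fun j => ?_, hlast⟩
  exact (mono_le x y N hN hxy j j.2 (N - 1) (by omega) (by omega)).trans_eq hlast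
end

section
/- Let a, b, c > 0 and τ ∈ ℕ with τ ≥ 1, set β = (1+b)^τ, and suppose a ≤ b·β. Then every solution (z_t)_{t≥0} of the delay recurrence z_{t+1} = H(z_t, z_{t−τ+1}) with nonnegative initial conditions z_0, …, z_{τ−1} ≥ 0 satisfies lim_{t→∞} z_t = 0. -/
/-- If `a ≤ b·β` (with `β = (1+b)^τ`, i.e. the delay is at least the critical
delay), then every solution of the delayed Beverton–Holt recurrence with
nonnegative initial conditions converges to the trivial equilibrium `0`. -/
theorem stmt10 (a b c : ℝ) (ha : 0 < a) (hb : 0 < b) (hc : 0 < c)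
    (τ : ℕ) (hτ : 1 ≤ τ) (hab : a ≤ b * (1 + b) ^ τ)
    (z : ℕ → ℝ) (hinit : ∀ i, i < τ → 0 ≤ z i)
    (hrec : ∀ t, z (t + τ) = Hfun a b c ((1 + b) ^ τ) (z (t + τ - 1)) (z t)) :
    Filter.Tendsto z Filter.atTop (nhds 0) := by
  have hB : 1 < (1 + b) ^ τ := one_lt_pow₀ (by linarith) (by omega)
  generalize (1 + b) ^ τ = B at *
  have hB1 : 0 < B - 1 := by linarith
  have hB0 : 0 < B := by linarith
  have hpos : ∀ t, 0 ≤ z t := by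
    intro t
    induction t using Nat.strong_induction_on with
    | _ t ih =>
      by_cases h : t < τ
      · exact hinit t h
      · obtain ⟨s, rfl⟩ : ∃ s, t = s + τ := ⟨t - τ, by omega⟩
        rw [hrec s]
        have h1 := ih (s + τ - 1) (by omega)
        have h2 := ih s (by omega)
        unfold Hfun
        positivity
  -- Lyapunov functional
  let V : ℕ → ℝ := fun t => z (t + τ - 1) + b * ∑ i ∈ Finset.range τ, z (t + i)
  have hVdiff : ∀ t, V t - V (t + 1) = z (t + τ - 1) + b * z t - (1 + b) * z (t + τ) := by
    intro t
    have e1 := Finset.sum_range_succ (fun i => z (t + i)) τ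
    have e2 := Finset.sum_range_succ' (fun i => z (t + i)) τ
    have e3 : ∑ i ∈ Finset.range τ, z (t + 1 + i) = ∑ i ∈ Finset.range τ, z (t + (i + 1)) :=
      Finset.sum_congr rfl (fun i _ => by congr 1; omega)
    have e4 : t + 1 + τ - 1 = t + τ := by omega
    simp only [V, e3, e4]
    simp only [add_zero] at e2
    have e5 : ∑ i ∈ Finset.range τ, z (t + (i + 1))
        = ∑ i ∈ Finset.range τ, z (t + i) + z (t + τ) - z t := by linarith
    rw [e5]; ring
  have hstep : ∀ t, b * (B - 1) * c * z t ^ 2 / (b * B + (B - 1) * c * z t)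
      ≤ V t - V (t + 1) := by
    intro t
    rw [hVdiff]
    have hu := hpos (t + τ - 1)
    have hv := hpos t
    have hw := hpos (t + τ)
    have hr := hrec t
    unfold Hfun at hr
    generalize z (t + τ - 1) = u at *
    generalize z (t + τ) = w at *
    generalize z t = v at *
    have hM : 0 < b * B + (B - 1) * c * v := by positivity
    have hm : 0 < 1 + b + c * u := by positivity
    have h1 : w * (1 + b + c * u) = u + a * b * v / (b * B + (B - 1) * c * v) := by
      rw [hr]; field_simp
    have h2 : 0 ≤ c * u * w := by positivity
    have h3 : a * b * v / (b * B + (B - 1) * c * v)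
        ≤ (b * B) * b * v / (b * B + (B - 1) * c * v) := by gcongr
    have h4 : (b * B) * b * v / (b * B + (B - 1) * c * v)
        + b * (B - 1) * c * v ^ 2 / (b * B + (B - 1) * c * v) = b * v := by
      rw [← add_div, div_eq_iff hM.ne']; ring
    linarith
  have hanti : Antitone V := antitone_nat_of_succ_le (fun t => by
    have h := hstep t
    have hv := hpos t
    have : 0 ≤ b * (B - 1) * c * z t ^ 2 / (b * B + (B - 1) * c * z t) := by positivity
    linarith)
  have hVz : ∀ t, b * z t ≤ V t := by
    intro t
    have h1 : z (t + 0) ≤ ∑ i ∈ Finset.range τ, z (t + i) :=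
      Finset.single_le_sum (f := fun i => z (t + i)) (fun i _ => hpos _)
        (Finset.mem_range.2 (by omega))
    have h2 := hpos (t + τ - 1)
    have h3 := mul_le_mul_of_nonneg_left h1 hb.le
    simp only [V]
    simp only [add_zero] at h3
    linarith
  have hV0 : ∀ t, 0 ≤ V t := fun t => (mul_nonneg hb.le (hpos t)).trans (hVz t)
  have hlim := tendsto_atTop_ciInf hanti ⟨0, by rintro _ ⟨t, rfl⟩; exact hV0 t⟩
  have hdiff : Filter.Tendsto (fun t => V t - V (t + 1)) Filter.atTop (nhds 0) := by
    simpa using hlim.sub (hlim.comp (Filter.tendsto_add_atTop_nat 1))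
  have hK0 := hV0 0
  have hD : 0 < b * B + (B - 1) * c * (V 0 / b) := by positivity
  have hsq : Filter.Tendsto (fun t => z t ^ 2) Filter.atTop (nhds 0) := by
    have hd2 := hdiff.const_mul ((b * B + (B - 1) * c * (V 0 / b)) / (b * (B - 1) * c))
    rw [mul_zero] at hd2
    refine squeeze_zero (fun t => sq_nonneg _) (fun t => ?_) hd2
    have hv := hpos t
    have hzK : z t ≤ V 0 / b := by
      rw [le_div_iff₀ hb]
      have := hVz t
      have := hanti (Nat.zero_le t)
      linarith
    have h1 : b * (B - 1) * c * z t ^ 2 / (b * B + (B - 1) * c * (V 0 / b))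
        ≤ V t - V (t + 1) := le_trans (by gcongr) (hstep t)
    have hE : 0 < b * (B - 1) * c := by positivity
    rw [div_le_iff₀ hD] at h1
    rw [div_mul_eq_mul_div, le_div_iff₀ hE]
    linarith
  have := hsq.sqrt
  simpa [Real.sqrt_sq (hpos _)] using this
end

section
/- Let a, b, c > 0 and τ ∈ ℕ with τ ≥ 1, set β = (1+b)^τ, suppose a > b·β, and let z₊ = (−b(2β−1) + √(b²(2β−1)² + 4b(a−bβ)(β−1)))/(2c(β−1)). Then c·z₊ ≤ 1 if and only if a·b ≤ (1+b)·(b·β + β − 1). -/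
/-- If `a > b·β` (with `β = (1+b)^τ`), then `c·z₊ ≤ 1` if and only if
`a·b ≤ (1+b)(b·β + β − 1)`. -/
theorem stmt11 (a b c : ℝ) (ha : 0 < a) (hb : 0 < b) (hc : 0 < c)
    (τ : ℕ) (hτ : 1 ≤ τ) (hab : b * (1 + b) ^ τ < a) :
    c * zplus a b c ((1 + b) ^ τ) ≤ 1 ↔
      a * b ≤ (1 + b) * (b * (1 + b) ^ τ + (1 + b) ^ τ - 1) := by
  have hβ : 1 < (1 + b) ^ τ := one_lt_pow₀ (by linarith) (by omega)
  generalize (1 + b) ^ τ = β at *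
  have hp : 0 < β - 1 := by linarith
  have hq : 0 < b * (2 * β - 1) := mul_pos hb (by linarith)
  unfold zplus
  rw [← mul_div_assoc, div_le_one (by positivity)]
  have h1 : ∀ s : ℝ, c * (-(b * (2 * β - 1)) + s) ≤ 2 * c * (β - 1) ↔
      s ≤ 2 * (β - 1) + b * (2 * β - 1) := by
    intro s
    rw [show 2 * c * (β - 1) = c * (2 * (β - 1)) by ring, mul_le_mul_iff_right₀ hc]
    constructor <;> intro h <;> linarith
  rw [h1, Real.sqrt_le_left (by linarith)]
  have h2 : (2 * (β - 1) + b * (2 * β - 1)) ^ 2 -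
      ((b * (2 * β - 1)) ^ 2 + 4 * b * (a - b * β) * (β - 1)) =
      4 * (β - 1) * ((1 + b) * (b * β + β - 1) - a * b) := by ring
  rw [← sub_nonneg, h2, mul_nonneg_iff_of_pos_left (by linarith), sub_nonneg]
end

section
/- Let a, b, c > 0 and τ ∈ ℕ with τ ≥ 1, set β = (1+b)^τ, suppose a > b·β and c·z₊ > 1, where z₊ is the unique positive equilibrium. Define χ = b(1+b)β / (c·(a·b − (β−1)(1+b))). Then for every solution (z_t)_{t≥0} of the delay recurrence z_{t+1} = H(z_t, z_{t−τ+1}) with nonnegative initial conditions not all zero, there exists T ∈ ℕ such that z_t ≥ χ for all t ≥ T. -/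
/-- Consequence of `c z₊ > 1`. -/
lemma aux_zplus (a b c β : ℝ) (hb : 0 < b) (hc : 0 < c) (hβ : 1 < β)
    (hcz : 1 < c * zplus a b c β) :
    b * (1 + b) * β < a * b - (β - 1) * (1 + b) := by
  unfold zplus at hcz
  have hp : 0 < β - 1 := by linarith
  have e : ∀ s : ℝ, c * (s / (2 * c * (β - 1))) = s / (2 * (β - 1)) := by
    intro s; field_simp
  rw [e, lt_div_iff₀ (by positivity)] at hcz
  have hB : 0 < b * (2 * β - 1) := mul_pos hb (by linarith)
  have h1 : 2 * (β - 1) + b * (2 * β - 1) <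
      Real.sqrt ((b * (2 * β - 1)) ^ 2 + 4 * b * (a - b * β) * (β - 1)) := by linarith
  rw [Real.lt_sqrt (by positivity)] at h1
  have h2 : (β - 1) * ((β - 1) + b * (2 * β - 1)) < (β - 1) * (b * (a - b * β)) := by
    nlinarith
  have h3 := lt_of_mul_lt_mul_left h2 hp.le
  nlinarith

/-- One step multiplies a lower bound `m ≤ X / c` by `1 / X`. -/
lemma aux_step (a b c β X m u v : ℝ) (hb : 0 < b) (hc : 0 < c) (hβ : 1 < β)
    (hX : 0 < X) (hXD : X * (a * b - (β - 1) * (1 + b)) = b * (1 + b) * β)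
    (hm : 0 < m) (hmX : c * m ≤ X) (hu : m ≤ u) (hv : m ≤ v) :
    m / X ≤ Hfun a b c β u v := by
  have hp : 0 < β - 1 := by linarith
  have hu0 : 0 < u := by linarith
  have hv0 : 0 < v := by linarith
  have hM : 0 < b * β + (β - 1) * c * v := by positivity
  have hm' : 0 < 1 + b + c * u := by positivity
  obtain ⟨D, hD⟩ : ∃ D, D = a * b - (β - 1) * (1 + b) := ⟨_, rfl⟩
  have hab : a * b = D + (β - 1) * (1 + b) := by linarith
  rw [← hD] at hXD
  have hg : (1 + b) * m / X ≤ a * b * v / (b * β + (β - 1) * c * v) := by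
    rw [div_le_div_iff₀ hX hM, hab]
    have e : (D + (β - 1) * (1 + b)) * v * X
        = (1 + b) * v * (b * β) + (1 + b) * (β - 1) * v * X := by
      linear_combination v * hXD
    rw [e]
    have h1 : (1 + b) * m * (b * β) ≤ (1 + b) * v * (b * β) := by gcongr
    have h2 : (1 + b) * (β - 1) * v * (c * m) ≤ (1 + b) * (β - 1) * v * X := by gcongr
    linarith
  unfold Hfun
  rw [one_div, inv_mul_eq_div, le_div_iff₀ hm']
  have h3 : m / X * (c * u) ≤ u := by
    rw [div_mul_eq_mul_div, div_le_iff₀ hX]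
    nlinarith
  have h4 : m / X * (1 + b) = (1 + b) * m / X := by ring
  linarith

lemma aux_nonneg (a b c β u v : ℝ) (ha : 0 < a) (hb : 0 < b) (hc : 0 < c) (hβ : 1 < β)
    (hu : 0 ≤ u) (hv : 0 ≤ v) : 0 ≤ Hfun a b c β u v := by
  have hp : 0 < β - 1 := by linarith
  unfold Hfun
  positivity

lemma aux_pos (a b c β u v : ℝ) (ha : 0 < a) (hb : 0 < b) (hc : 0 < c) (hβ : 1 < β)
    (hu : 0 ≤ u) (hv : 0 ≤ v) (h : 0 < u ∨ 0 < v) : 0 < Hfun a b c β u v := by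
  have hp : 0 < β - 1 := by linarith
  unfold Hfun
  rcases h with h | h <;> positivity

/-- Eventual lower bound: if `a > b·β` and `c·z₊ > 1`, every solution with
nonnegative initial conditions, not all zero, eventually stays above
`χ = b(1+b)β / (c(ab − (β−1)(1+b)))`. -/
theorem stmt15 (a b c : ℝ) (ha : 0 < a) (hb : 0 < b) (hc : 0 < c)
    (τ : ℕ) (hτ : 1 ≤ τ) (hab : b * (1 + b) ^ τ < a)
    (hcz : 1 < c * zplus a b c ((1 + b) ^ τ))
    (z : ℕ → ℝ) (hinit : ∀ i, i < τ → 0 ≤ z i)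
    (hnz : ¬ ∀ i, i < τ → z i = 0)
    (hrec : ∀ t, z (t + τ) = Hfun a b c ((1 + b) ^ τ) (z (t + τ - 1)) (z t)) :
    ∃ T : ℕ, ∀ t, T ≤ t →
      b * (1 + b) * (1 + b) ^ τ /
        (c * (a * b - ((1 + b) ^ τ - 1) * (1 + b))) ≤ z t := by
  have hβ : 1 < (1 + b) ^ τ := one_lt_pow₀ (by linarith) (by omega)
  generalize (1 + b) ^ τ = β at *
  have hD := aux_zplus a b c β hb hc hβ hcz
  have hN : 0 < b * (1 + b) * β := by positivity
  have hD0 : 0 < a * b - (β - 1) * (1 + b) := by linarith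
  obtain ⟨X, hXdef⟩ : ∃ X, X = b * (1 + b) * β / (a * b - (β - 1) * (1 + b)) := ⟨_, rfl⟩
  have hX : 0 < X := by rw [hXdef]; positivity
  have hX1 : X < 1 := by rw [hXdef, div_lt_one hD0]; exact hD
  have hXD : X * (a * b - (β - 1) * (1 + b)) = b * (1 + b) * β := by
    rw [hXdef]; exact div_mul_cancel₀ _ hD0.ne'
  have hχ : b * (1 + b) * β / (c * (a * b - (β - 1) * (1 + b))) = X / c := by
    rw [hXdef, div_div, mul_comm c]
  rw [hχ]
  have hnn : ∀ t, 0 ≤ z t := by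
    intro t
    induction t using Nat.strong_induction_on with
    | _ t ih =>
      by_cases h : t < τ
      · exact hinit t h
      · obtain ⟨s, rfl⟩ := Nat.exists_eq_add_of_le' (not_lt.mp h)
        rw [hrec]
        exact aux_nonneg a b c β _ _ ha hb hc hβ (ih _ (by omega)) (ih _ (by omega))
  push Not at hnz
  obtain ⟨i, hi, hzi⟩ := hnz
  have hzi' : 0 < z i := lt_of_le_of_ne (hnn i) (Ne.symm hzi)
  have hpos : ∀ k, 0 < z (i + k + τ) := by
    intro k
    induction k with
    | zero =>
      rw [hrec]
      exact aux_pos a b c β _ _ ha hb hc hβ (hnn _) (hnn _) (Or.inr hzi')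
    | succ k ih =>
      rw [hrec]
      refine aux_pos a b c β _ _ ha hb hc hβ (hnn _) (hnn _) (Or.inl ?_)
      have : i + (k + 1) + τ - 1 = i + k + τ := by omega
      rw [this]; exact ih
  have hstep : ∀ m t, 0 < m → c * m ≤ X → m ≤ z (t + τ - 1) → m ≤ z t →
      m / X ≤ z (t + τ) := by
    intro m t hm hmX h1 h2
    rw [hrec]
    exact aux_step a b c β X m _ _ hb hc hβ hX hXD hm hmX h1 h2
  -- an initial positive lower bound
  obtain ⟨m0, hm0, hm0X, hm0z⟩ : ∃ m, 0 < m ∧ c * m ≤ X ∧ ∀ k, k < τ → m ≤ z (i + k + τ) := by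
    have aux : ∀ n : ℕ, ∃ m, 0 < m ∧ c * m ≤ X ∧ ∀ k, k < n → m ≤ z (i + k + τ) := by
      intro n
      induction n with
      | zero => exact ⟨X / c, by positivity, by rw [mul_div_cancel₀ _ hc.ne'], by simp⟩
      | succ n ih =>
        obtain ⟨m, h1, h2, h3⟩ := ih
        refine ⟨min m (z (i + n + τ)), lt_min h1 (hpos n), ?_, ?_⟩
        · exact le_trans (mul_le_mul_of_nonneg_left (min_le_left _ _) hc.le) h2
        · intro k hk
          rcases Nat.lt_succ_iff_lt_or_eq.mp hk with h | rfl
          · exact (min_le_left _ _).trans (h3 k h)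
          · exact min_le_right _ _
    exact aux τ
  have hall : ∀ k, m0 ≤ z (i + k + τ) := by
    intro k
    induction k using Nat.strong_induction_on with
    | _ k ih =>
      by_cases h : k < τ
      · exact hm0z k h
      · have h1 := ih (k - τ) (by omega)
        have h2 := ih (k - 1) (by omega)
        have e1 : i + (k - τ) + τ = i + k := by omega
        have e2 : i + (k - 1) + τ = i + k + τ - 1 := by omega
        rw [e1] at h1
        rw [e2] at h2
        refine le_trans ?_ (hstep m0 _ hm0 hm0X h2 h1)
        rw [le_div_iff₀ hX]
        nlinarith
  have hiter : ∀ k : ℕ, ∃ T : ℕ, ∀ t, T ≤ t → min (X / c) (m0 / X ^ k) ≤ z t := by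
    intro k
    induction k with
    | zero =>
      refine ⟨i + τ, fun t ht => (min_le_right _ _).trans ?_⟩
      have := hall (t - (i + τ))
      have e : i + (t - (i + τ)) + τ = t := by omega
      rw [e] at this
      simpa using this
    | succ k ih =>
      obtain ⟨T, hT⟩ := ih
      refine ⟨T + τ, fun t ht => ?_⟩
      obtain ⟨s, rfl⟩ := Nat.exists_eq_add_of_le' (show τ ≤ t by omega)
      have hmin : 0 < min (X / c) (m0 / X ^ k) := lt_min (by positivity) (by positivity)
      have hle : c * min (X / c) (m0 / X ^ k) ≤ X := by
        have := mul_le_mul_of_nonneg_left (min_le_left (X / c) (m0 / X ^ k)) hc.le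
        rwa [mul_div_cancel₀ _ hc.ne'] at this
      refine le_trans ?_ (hstep _ s hmin hle (hT _ (by omega)) (hT _ (by omega)))
      rw [le_div_iff₀ hX]
      refine le_min ?_ ?_
      · have h1 := min_le_left (X / c) (m0 / X ^ (k + 1))
        have h2 : 0 < X / c := by positivity
        nlinarith
      · have h1 := min_le_right (X / c) (m0 / X ^ (k + 1))
        have h2 : m0 / X ^ (k + 1) * X = m0 / X ^ k := by rw [pow_succ]; field_simp
        rw [← h2]
        exact mul_le_mul_of_nonneg_right h1 hX.le
  obtain ⟨k, hk⟩ := exists_pow_lt_of_lt_one (show 0 < m0 * c / X by positivity) hX1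
  obtain ⟨T, hT⟩ := hiter k
  refine ⟨T, fun t ht => le_trans (le_min le_rfl ?_) (hT t ht)⟩
  rw [lt_div_iff₀ hX] at hk
  rw [div_le_div_iff₀ hc (by positivity)]
  linarith
end

section
/- Let a, b, c > 0 and τ ∈ ℕ with τ ≥ 1, set β = (1+b)^τ, suppose a > b·β and c·z₊ > 1, where z₊ is the unique positive equilibrium. Define χ = b(1+b)β / (c·(a·b − (β−1)(1+b))). Then a·b > (β−1)(1+b) (so χ is a well-defined positive number), c·χ < 1, and χ < z₊. -/
/-- Properties of `χ = b(1+b)β / (c(ab − (β−1)(1+b)))` when `a > b·β` and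
`c·z₊ > 1`: the denominator is positive (`ab > (β−1)(1+b)`), and `cχ < 1`,
`χ < z₊`. -/
theorem stmt16 (a b c : ℝ) (ha : 0 < a) (hb : 0 < b) (hc : 0 < c)
    (τ : ℕ) (hτ : 1 ≤ τ) (hab : b * (1 + b) ^ τ < a)
    (hcz : 1 < c * zplus a b c ((1 + b) ^ τ)) :
    let β := (1 + b) ^ τ
    let χ := b * (1 + b) * β / (c * (a * b - (β - 1) * (1 + b)))
    (β - 1) * (1 + b) < a * b ∧ c * χ < 1 ∧ χ < zplus a b c β := by
  intro β χ
  have hβ : 1 < β := one_lt_pow₀ (by linarith) (by omega)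
  have hab' : b * β < a := hab
  have hcz' : 1 < c * zplus a b c β := hcz
  have hd : 0 < β - 1 := by linarith
  have key : b * (1 + b) * β < a * b - (β - 1) * (1 + b) := by
    have h := hcz'
    unfold zplus at h
    rw [← mul_div_assoc, lt_div_iff₀ (by positivity)] at h
    have h1 : 2 * (β - 1) + b * (2 * β - 1) <
        Real.sqrt ((b * (2 * β - 1)) ^ 2 + 4 * b * (a - b * β) * (β - 1)) := by
      refine lt_of_mul_lt_mul_left ?_ hc.le
      linarith
    have hP : 0 < b * (2 * β - 1) := mul_pos hb (by linarith)
    rw [Real.lt_sqrt (by linarith)] at h1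
    have h2 : (β - 1) * ((β - 1) + b * (2 * β - 1)) < (β - 1) * (b * (a - b * β)) := by
      linarith
    have h3 := lt_of_mul_lt_mul_left h2 hd.le
    linarith
  have hn : 0 < b * (1 + b) * β := by positivity
  have hD : 0 < a * b - (β - 1) * (1 + b) := by linarith
  have hχ : c * χ < 1 := by
    have : c * χ = b * (1 + b) * β / (a * b - (β - 1) * (1 + b)) := by
      simp only [χ]
      field_simp
    rw [this, div_lt_one hD]
    exact key
  exact ⟨by linarith, hχ, lt_of_mul_lt_mul_left (hχ.trans hcz') hc.le⟩
end

section
/- Let a, b, c > 0 and τ ∈ ℕ with τ ≥ 1, set β = (1+b)^τ, suppose a > b·β and c·z₊ > 1, where z₊ is the unique positive equilibrium, and define χ = b(1+b)β / (c·(a·b − (β−1)(1+b))). Then there exists U* > z₊ such that for all U ≥ U* and all u, v ∈ [χ, U], one has H(u, v) ∈ [χ, U]. -/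
/-- Existence of invariant intervals: if `a > b·β` and `c·z₊ > 1`, with
`χ = b(1+b)β / (c(ab − (β−1)(1+b)))`, there exists `U* > z₊` such that for all
`U ≥ U*`, `H` maps `[χ,U] × [χ,U]` into `[χ,U]`. -/
theorem stmt17 (a b c : ℝ) (ha : 0 < a) (hb : 0 < b) (hc : 0 < c)
    (τ : ℕ) (hτ : 1 ≤ τ) (hab : b * (1 + b) ^ τ < a)
    (hcz : 1 < c * zplus a b c ((1 + b) ^ τ)) :
    let β := (1 + b) ^ τ
    let χ := b * (1 + b) * β / (c * (a * b - (β - 1) * (1 + b)))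
    ∃ Ustar : ℝ, zplus a b c β < Ustar ∧
      ∀ U, Ustar ≤ U → ∀ u ∈ Set.Icc χ U, ∀ v ∈ Set.Icc χ U,
        Hfun a b c β u v ∈ Set.Icc χ U := by
  intro β χ
  have hβ : 1 < β := one_lt_pow₀ (by linarith) (by omega)
  have hβ0 : 0 < β - 1 := by linarith
  change 1 < c * zplus a b c β at hcz
  change b * β < a at hab
  have hz : 0 < zplus a b c β := by
    by_contra h
    push Not at h
    nlinarith
  have hD : b * (1 + b) * β < a * b - (β - 1) * (1 + b) := by
    have h1 : c * zplus a b c β = (-(b * (2 * β - 1)) +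
      Real.sqrt ((b * (2 * β - 1)) ^ 2 + 4 * b * (a - b * β) * (β - 1))) / (2 * (β - 1)) := by
      unfold zplus
      field_simp
    rw [h1, lt_div_iff₀ (by positivity)] at hcz
    have h2 : b * (2 * β - 1) + 2 * (β - 1) <
      Real.sqrt ((b * (2 * β - 1)) ^ 2 + 4 * b * (a - b * β) * (β - 1)) := by linarith
    have h3 : 0 < 2 * β - 1 := by linarith
    rw [Real.lt_sqrt (by positivity)] at h2
    have h4 : 0 < (4 * (β - 1)) * (b * (a - b * β) - (β - 1) - b * (2 * β - 1)) := by
      nlinarith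
    have h5 := (mul_pos_iff_of_pos_left (by positivity)).1 h4
    nlinarith
  have hN : 0 < b * (1 + b) * β := by positivity
  have hD0 : 0 < a * b - (β - 1) * (1 + b) := by linarith
  have hχ0 : 0 < χ := by positivity
  have hχ1 : χ ≤ 1 / c := by
    change b * (1 + b) * β / (c * (a * b - (β - 1) * (1 + b))) ≤ 1 / c
    rw [div_le_div_iff₀ (by positivity) hc]
    nlinarith
  have hK : 0 < a * b / ((β - 1) * c) := by positivity
  have hc' : 0 < 1 / c := by positivity
  refine ⟨1 / c + a * b / ((β - 1) * c) + zplus a b c β, by linarith, ?_⟩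
  intro U hU u hu v hv
  have hu0 : 0 < u := lt_of_lt_of_le hχ0 hu.1
  have hv0 : 0 < v := lt_of_lt_of_le hχ0 hv.1
  have hv1 : b * (1 + b) * β ≤ v * (c * (a * b - (β - 1) * (1 + b))) :=
    (div_le_iff₀ (by positivity)).1 hv.1
  have hM : 0 < b * β + (β - 1) * c * v := by positivity
  have hq1 : (1 + b) / c ≤ a * b * v / (b * β + (β - 1) * c * v) := by
    rw [div_le_div_iff₀ hc hM]
    nlinarith
  have hq2 : a * b * v / (b * β + (β - 1) * c * v) ≤ a * b / ((β - 1) * c) := by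
    rw [div_le_div_iff₀ hM (by positivity)]
    have : 0 < a * b * (b * β) := by positivity
    nlinarith
  have hm : 0 < 1 + b + c * u := by positivity
  unfold Hfun
  generalize a * b * v / (b * β + (β - 1) * c * v) = q at *
  generalize a * b / ((β - 1) * c) = K at *
  rw [div_mul_eq_mul_div, one_mul]
  constructor
  · refine hχ1.trans ?_
    rw [div_le_iff₀ hc] at hq1
    rw [div_le_div_iff₀ hc hm]
    nlinarith
  · have : (u + q) / (1 + b + c * u) ≤ 1 / c + K := by
      rw [div_le_iff₀ hm]
      have e : (1 / c + K) * (1 + b + c * u) = (1 + b) * (1 / c) + u + K + K * b + K * (c * u) := by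
        field_simp
        ring
      rw [e]
      have : 0 < (1 + b) * (1 / c) := by positivity
      have : 0 < K * b := by positivity
      have : 0 < K * (c * u) := by positivity
      linarith
    linarith
end

section
/- Let a, b, c > 0 and τ ∈ ℕ with τ ≥ 1, set β = (1+b)^τ, suppose a > b·β and c·z₊ > 1, where z₊ is the unique positive equilibrium. Then every solution (z_t)_{t≥0} of the delay recurrence z_{t+1} = H(z_t, z_{t−τ+1}) with nonnegative initial conditions not all zero satisfies lim_{t→∞} z_t = z₊. -/
open Filter Topology

namespace Aux18

noncomputable def F (A b β v : ℝ) : ℝ := A * v / (b * β + (β - 1) * v)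
noncomputable def G (A b β u v : ℝ) : ℝ := (u + F A b β v) / (1 + b + u)

section
variable {A b β : ℝ}

lemma F_nonneg (hA : 0 < A) (hb : 0 < b) (hβ : 1 < β) {v : ℝ} (hv : 0 ≤ v) :
    0 ≤ F A b β v := by
  have : 0 < β - 1 := by linarith
  unfold F; positivity

lemma F_pos (hA : 0 < A) (hb : 0 < b) (hβ : 1 < β) {v : ℝ} (hv : 0 < v) :
    0 < F A b β v := by
  have : 0 < β - 1 := by linarith
  unfold F; positivity

lemma F_le (hA : 0 < A) (hb : 0 < b) (hβ : 1 < β) {v : ℝ} (hv : 0 ≤ v) :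
    F A b β v ≤ A / (β - 1) := by
  have : 0 < β - 1 := by linarith
  unfold F
  rw [div_le_div_iff₀ (by positivity) this]
  have : 0 < A * (b * β) := by positivity
  nlinarith

lemma F_mono (hA : 0 < A) (hb : 0 < b) (hβ : 1 < β) {v w : ℝ} (hv : 0 ≤ v) (h : v ≤ w) :
    F A b β v ≤ F A b β w := by
  have : 0 < β - 1 := by linarith
  have hw : 0 ≤ w := hv.trans h
  unfold F
  rw [div_le_div_iff₀ (by positivity) (by positivity)]
  have : 0 < A * (b * β) := by positivity
  nlinarith

lemma F_cont (hb : 0 < b) (hβ : 1 < β) {v : ℝ} (hv : 0 ≤ v) :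
    ContinuousAt (F A b β) v := by
  have : 0 < β - 1 := by linarith
  unfold F
  have : b * β + (β - 1) * v ≠ 0 := by positivity
  fun_prop (disch := assumption)

lemma G_mono_v (hA : 0 < A) (hb : 0 < b) (hβ : 1 < β) {u v w : ℝ} (hu : 0 ≤ u)
    (hv : 0 ≤ v) (h : v ≤ w) : G A b β u v ≤ G A b β u w := by
  have := F_mono hA hb hβ hv h
  unfold G
  gcongr

lemma G_ge_one (hb : 0 < b) {u v : ℝ} (hu : 0 ≤ u) (h : 1 + b ≤ F A b β v) :
    1 ≤ G A b β u v := by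
  unfold G
  rw [le_div_iff₀ (by positivity)]
  linarith

lemma G_anti_u (hb : 0 < b) {u w v : ℝ} (hu : 0 ≤ u) (huw : u ≤ w)
    (h : 1 + b ≤ F A b β v) : G A b β w v ≤ G A b β u v := by
  have hw := hu.trans huw
  unfold G
  rw [div_le_div_iff₀ (by positivity) (by positivity)]
  nlinarith

lemma G_mono_u (hb : 0 < b) {u w v : ℝ} (hu : 0 ≤ u) (huw : u ≤ w)
    (h : F A b β v ≤ 1 + b) : G A b β u v ≤ G A b β w v := by
  have hw := hu.trans huw
  unfold G
  rw [div_le_div_iff₀ (by positivity) (by positivity)]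
  nlinarith

lemma G_lower (hA : 0 < A) (hb : 0 < b) (hβ : 1 < β) {m u v : ℝ} (hm : 0 ≤ m)
    (hu : m ≤ u) (hv : m ≤ v) : min 1 (G A b β m m) ≤ G A b β u v := by
  rcases le_total (1 + b) (F A b β v) with h | h
  · exact (min_le_left _ _).trans (G_ge_one hb (hm.trans hu) h)
  · exact (min_le_right _ _).trans
      ((G_mono_v hA hb hβ hm hm hv).trans (G_mono_u hb hm hu h))

lemma G_gt (hA : 0 < A) (hb : 0 < b) (hβ : 1 < β)
    (h1 : (β - 1) + b * (2 * β - 1) + b ^ 2 * β < A) {m : ℝ} (hm : 0 < m) (hm1 : m ≤ 1) :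
    m < G A b β m m := by
  have hβ' : 0 < β - 1 := by linarith
  have hF : m * (b + m) < F A b β m := by
    unfold F
    rw [lt_div_iff₀ (by positivity)]
    have : (b + m) * (b * β + (β - 1) * m) < A := by
      have : (b + m) * (b * β + (β - 1) * m) ≤ (b + 1) * (b * β + (β - 1) * 1) := by
        gcongr
      nlinarith
    nlinarith
  unfold G
  rw [lt_div_iff₀ (by positivity)]
  nlinarith

lemma G_nonneg (hA : 0 < A) (hb : 0 < b) (hβ : 1 < β) {u v : ℝ} (hu : 0 ≤ u) (hv : 0 ≤ v) :
    0 ≤ G A b β u v := by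
  have := F_nonneg hA hb hβ hv
  unfold G; positivity

lemma G_pos (hA : 0 < A) (hb : 0 < b) (hβ : 1 < β) {u v : ℝ} (hu : 0 ≤ u) (hv : 0 ≤ v)
    (h : 0 < u ∨ 0 < v) : 0 < G A b β u v := by
  have := F_nonneg hA hb hβ hv
  have : 0 < u + F A b β v := by
    rcases h with h | h
    · linarith
    · have := F_pos hA hb hβ h
      linarith
  unfold G; positivity

lemma G_le (hA : 0 < A) (hb : 0 < b) (hβ : 1 < β) {u v : ℝ} (hu : 0 ≤ u) (hv : 0 ≤ v) :
    G A b β u v ≤ 1 + A / (β - 1) := by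
  have h1 := F_le hA hb hβ hv
  have h2 := F_nonneg hA hb hβ hv
  unfold G
  rw [div_le_iff₀ (by positivity)]
  nlinarith [mul_nonneg (h2.trans h1) hb.le, mul_nonneg (h2.trans h1) hu]

lemma G_tendsto (hb : 0 < b) (hβ : 1 < β) {u v : ℝ} (hu : 0 ≤ u) (hv : 0 ≤ v)
    {p q : ℝ → ℝ} {l : Filter ℝ} (hp : Tendsto p l (𝓝 u)) (hq : Tendsto q l (𝓝 v)) :
    Tendsto (fun e => G A b β (p e) (q e)) l (𝓝 (G A b β u v)) := by
  unfold G
  exact (hp.add ((F_cont hb hβ hv).tendsto.comp hq)).div (hp.const_add _) (by positivity)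

/-- algebraic core -/
lemma no_two (hA : 0 < A) (hb : 0 < b) (hβ : 1 + b ≤ β) {I S : ℝ} (hI : 1 ≤ I) (hIS : I ≤ S)
    (h1 : S ≤ G A b β I S) (h2 : G A b β S I ≤ I) : S = I := by
  by_contra hne
  have hlt : I < S := lt_of_le_of_ne hIS (Ne.symm hne)
  have hS : 1 < S := by linarith
  have hβ' : 0 < β - 1 := by linarith
  have hβ0 : 0 < β := by linarith
  have hMS : 0 < b * β + (β - 1) * S := by positivity
  have hMI : 0 < b * β + (β - 1) * I := by positivity
  unfold G at h1 h2
  rw [le_div_iff₀ (by positivity)] at h1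
  rw [div_le_iff₀ (by positivity)] at h2
  have e1 : S * (1 + b + I) - I ≤ F A b β S := by linarith
  have e2 : F A b β I ≤ I * (1 + b + S) - S := by linarith
  unfold F at e1 e2
  rw [le_div_iff₀ hMS] at e1
  rw [div_le_iff₀ hMI] at e2
  have e3 : I * ((S * (1 + b + I) - I) * (b * β + (β - 1) * S)) ≤
      S * ((I * (1 + b + S) - S) * (b * β + (β - 1) * I)) := by
    have := mul_le_mul_of_nonneg_left e1 (by linarith : 0 ≤ I)
    have := mul_le_mul_of_nonneg_left e2 (by linarith : 0 ≤ S)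
    linarith
  have e4 : (S - I) * ((β - 1) * (S * I * (2 + b))) ≤ (S - I) * ((b * β) * (S * I - S - I)) := by
    linarith
  have e5 := le_of_mul_le_mul_left e4 (by linarith)
  have hk : b * β ≤ (1 + b) * (β - 1) := by nlinarith
  have hSI : 0 < S * I := by positivity
  have hbβ : 0 < b * β := by positivity
  nlinarith [mul_pos hbβ (by linarith : 0 < S + I), mul_le_mul_of_nonneg_right hk hSI.le,
    mul_pos hβ' hSI]

lemma eqn {L : ℝ} (hb : 0 < b) (hβ : 1 < β) (hL : 1 ≤ L) (h : L = G A b β L L) :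
    (β - 1) * L ^ 2 + b * (2 * β - 1) * L + b ^ 2 * β = A := by
  have hβ' : 0 < β - 1 := by linarith
  have hM : 0 < b * β + (β - 1) * L := by positivity
  unfold G at h
  rw [eq_div_iff (by positivity)] at h
  have h2 : F A b β L = L * (b + L) := by linarith
  unfold F at h2
  rw [div_eq_iff hM.ne'] at h2
  have : L * A = L * ((β - 1) * L ^ 2 + b * (2 * β - 1) * L + b ^ 2 * β) := by
    linarith
  exact (mul_left_cancel₀ (by positivity) this).symm

lemma step {x : ℕ → ℝ} {τ : ℕ}
    (hx : ∀ t, x (t + τ) = G A b β (x (t + τ - 1)) (x t)) {P Q : ℝ → Prop}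
    (hPQ : ∀ u v, P u → P v → Q (G A b β u v)) (h : ∀ᶠ t in atTop, P (x t)) :
    ∀ᶠ t in atTop, Q (x t) := by
  obtain ⟨N, hN⟩ := eventually_atTop.1 h
  refine eventually_atTop.2 ⟨N + τ + 1, fun t ht => ?_⟩
  obtain ⟨s, rfl⟩ : ∃ s, t = s + τ := ⟨t - τ, by omega⟩
  rw [hx]
  exact hPQ _ _ (hN _ (by omega)) (hN _ (by omega))

lemma core (hA : 0 < A) (hb : 0 < b) (hβ1 : 1 + b ≤ β)
    (h1 : (β - 1) + b * (2 * β - 1) + b ^ 2 * β < A) {x : ℕ → ℝ} {τ : ℕ} (hτ : 1 ≤ τ)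
    (hinit : ∀ i, i < τ → 0 ≤ x i) (hnz : ¬ ∀ i, i < τ → x i = 0)
    (hx : ∀ t, x (t + τ) = G A b β (x (t + τ - 1)) (x t)) :
    ∃ L, 1 ≤ L ∧ (β - 1) * L ^ 2 + b * (2 * β - 1) * L + b ^ 2 * β = A ∧
      Tendsto x atTop (𝓝 L) := by
  have hβ : 1 < β := by linarith
  have hβ' : 0 < β - 1 := by linarith
  have hnn : ∀ t, 0 ≤ x t := by
    intro t
    induction t using Nat.strong_induction_on with
    | _ t ih =>
      rcases lt_or_ge t τ with h | h
      · exact hinit t h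
      · obtain ⟨s, rfl⟩ : ∃ s, t = s + τ := ⟨t - τ, by omega⟩
        rw [hx]
        exact G_nonneg hA hb hβ (ih _ (by omega)) (ih _ (by omega))
  obtain ⟨i, hi, hxi⟩ : ∃ i, i < τ ∧ 0 < x i := by
    push Not at hnz
    obtain ⟨i, hi, h⟩ := hnz
    exact ⟨i, hi, lt_of_le_of_ne (hnn i) (Ne.symm h)⟩
  have hpos : ∀ k, 0 < x (i + τ + k) := by
    intro k
    induction k with
    | zero => rw [add_zero, hx]; exact G_pos hA hb hβ (hnn _) (hnn _) (Or.inr hxi)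
    | succ k ih =>
      rw [show i + τ + (k + 1) = (i + k + 1) + τ by ring, hx]
      refine G_pos hA hb hβ (hnn _) (hnn _) (Or.inl ?_)
      rwa [show i + k + 1 + τ - 1 = i + τ + k by omega]
  -- uniform lower bound
  obtain ⟨m, hm0, hm1, hm⟩ : ∃ m, 0 < m ∧ m ≤ 1 ∧ ∀ k, k < τ → m ≤ x (i + τ + k) := by
    have : ∀ n : ℕ, ∃ m, 0 < m ∧ m ≤ 1 ∧ ∀ k, k < n → m ≤ x (i + τ + k) := by
      intro n
      induction n with
      | zero => exact ⟨1, one_pos, le_rfl, by simp⟩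
      | succ n ih =>
        obtain ⟨m, h0, h1, h2⟩ := ih
        refine ⟨min m (x (i + τ + n)), lt_min h0 (hpos n), (min_le_left _ _).trans h1, ?_⟩
        intro k hk
        rcases Nat.lt_succ_iff_lt_or_eq.1 hk with h | h
        · exact (min_le_left _ _).trans (h2 k h)
        · rw [h]; exact min_le_right _ _
    exact this τ
  have hlow : ∀ k, m ≤ x (i + τ + k) := by
    intro k
    induction k using Nat.strong_induction_on with
    | _ k ih =>
      rcases lt_or_ge k τ with h | h
      · exact hm k h
      · obtain ⟨s, rfl⟩ : ∃ s, k = s + τ := ⟨k - τ, by omega⟩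
        rw [show i + τ + (s + τ) = (i + τ + s) + τ by ring, hx]
        refine le_trans ?_ (G_lower hA hb hβ hm0.le ?_ (ih s (by omega)))
        · exact le_min hm1 (G_gt hA hb hβ h1 hm0 hm1).le
        · rw [show i + τ + s + τ - 1 = i + τ + (s + τ - 1) by omega]
          exact ih _ (by omega)
  have hevm : ∀ᶠ t in atTop, m ≤ x t := by
    refine eventually_atTop.2 ⟨i + τ, fun t ht => ?_⟩
    obtain ⟨k, rfl⟩ := Nat.exists_eq_add_of_le ht
    exact hlow k
  have hevB : ∀ᶠ t in atTop, x t ≤ 1 + A / (β - 1) :=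
    step (P := fun u => 0 ≤ u) (Q := fun u => u ≤ 1 + A / (β - 1)) hx
      (fun u v hu hv => G_le hA hb hβ hu hv) (Eventually.of_forall hnn)
  have bd1 : IsBoundedUnder (· ≤ ·) atTop x := ⟨_, by simpa using hevB⟩
  have bd2 : IsBoundedUnder (· ≥ ·) atTop x := ⟨m, by simpa using hevm⟩
  set I := liminf x atTop with hI
  set S := limsup x atTop with hS
  have hIS : I ≤ S := liminf_le_limsup bd1 bd2
  have hIge : ∀ r, (∀ᶠ t in atTop, r ≤ x t) → r ≤ I := fun r h =>
    le_liminf_of_le bd1.isCoboundedUnder_ge h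
  have hSle : ∀ r, (∀ᶠ t in atTop, x t ≤ r) → S ≤ r := fun r h =>
    limsup_le_of_le bd2.isCoboundedUnder_le h
  have evI : ∀ e > 0, ∀ᶠ t in atTop, I - e ≤ x t := fun e he =>
    (eventually_lt_of_lt_liminf (by linarith : I - e < I) bd2).mono fun _ h => h.le
  have evS : ∀ e > 0, ∀ᶠ t in atTop, x t ≤ S + e := fun e he =>
    (eventually_lt_of_limsup_lt (by linarith : S < S + e) bd1).mono fun _ h => h.le
  have hmI : m ≤ I := hIge m hevm
  have t0 : Tendsto (fun e : ℝ => e) (𝓝[>] 0) (𝓝 0) := nhdsWithin_le_nhds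
  -- stage 1
  have hI1 : 1 ≤ I := by
    by_contra hlt
    push Not at hlt
    have hmI' : 0 < I := by linarith
    have tI : Tendsto (fun e : ℝ => max 0 (I - e)) (𝓝[>] 0) (𝓝 I) := by
      have := (tendsto_const_nhds (x := (0:ℝ))).max (t0.const_sub I)
      simpa [max_eq_right hmI'.le] using this
    have key : min 1 (G A b β I I) ≤ I := by
      refine le_of_tendsto (tendsto_const_nhds.min (G_tendsto hb hβ hmI'.le hmI'.le tI tI)) ?_
      filter_upwards [self_mem_nhdsWithin] with e he
      refine hIge _ (step (P := fun u => max 0 (I - e) ≤ u)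
        (Q := fun u => min 1 (G A b β (max 0 (I - e)) (max 0 (I - e))) ≤ u) hx
        (fun u v hu hv => G_lower hA hb hβ (le_max_left _ _) hu hv) ?_)
      filter_upwards [evI e he] with t ht
      exact max_le (hnn t) ht
    have := lt_min hlt (G_gt hA hb hβ h1 hmI' hlt.le)
    linarith
  have hF1 : 1 + b < F A b β 1 := by
    unfold F
    rw [lt_div_iff₀ (by positivity)]
    nlinarith
  have hev1 : ∀ᶠ t in atTop, 1 ≤ x t := by
    obtain ⟨r, hr0, hr1, hrF⟩ : ∃ r, 0 ≤ r ∧ r < 1 ∧ 1 + b < F A b β r := by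
      have h := (F_cont (A := A) hb hβ zero_le_one).eventually (lt_mem_nhds hF1)
      have h2 : ∀ᶠ r in 𝓝[<] (1:ℝ), 1 + b < F A b β r := nhdsWithin_le_nhds h
      have h3 : ∀ᶠ r in 𝓝[<] (1:ℝ), 0 < r := nhdsWithin_le_nhds (lt_mem_nhds one_pos)
      obtain ⟨r, ha, hb, hc⟩ := (h2.and (h3.and self_mem_nhdsWithin)).exists
      exact ⟨r, hb.le, hc, ha⟩
    refine step (P := fun u => r ≤ u) (Q := fun u => 1 ≤ u) hx (fun u v hu hv => ?_) ?_
    · exact G_ge_one hb (hr0.trans hu) (hrF.le.trans (F_mono hA hb hβ hr0 hv))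
    · filter_upwards [evI (1 - r) (by linarith)] with t ht
      linarith
  have hFv : ∀ v, 1 ≤ v → 1 + b ≤ F A b β v := fun v hv =>
    hF1.le.trans (F_mono hA hb hβ zero_le_one hv)
  have tI : Tendsto (fun e : ℝ => max 1 (I - e)) (𝓝[>] 0) (𝓝 I) := by
    have := (tendsto_const_nhds (x := (1:ℝ))).max (t0.const_sub I)
    simpa [max_eq_right hI1] using this
  have tS : Tendsto (fun e : ℝ => S + e) (𝓝[>] 0) (𝓝 S) := by
    simpa using t0.const_add S
  have hI0 : 0 ≤ I := by linarith
  have hS0 : 0 ≤ S := by linarith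
  have evP : ∀ e > 0, ∀ᶠ t in atTop, max 1 (I - e) ≤ x t ∧ x t ≤ S + e := by
    intro e he
    filter_upwards [evI e he, evS e he, hev1] with t h1 h2 h3
    exact ⟨max_le h3 h1, h2⟩
  have k1 : S ≤ G A b β I S := by
    refine ge_of_tendsto (G_tendsto hb hβ hI0 hS0 tI tS) ?_
    filter_upwards [self_mem_nhdsWithin] with e he
    refine hSle _ (step (P := fun u => max 1 (I - e) ≤ u ∧ u ≤ S + e)
        (Q := fun u => u ≤ G A b β (max 1 (I - e)) (S + e)) hx
        (fun u v hu hv => ?_) (evP e he))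
    have hm1 : 1 ≤ max 1 (I - e) := le_max_left _ _
    exact (G_anti_u hb (by linarith) hu.1 (hFv v (hm1.trans hv.1))).trans
      (G_mono_v hA hb hβ (by linarith) (by linarith [hv.1]) hv.2)
  have k2 : G A b β S I ≤ I := by
    refine le_of_tendsto (G_tendsto hb hβ hS0 hI0 tS tI) ?_
    filter_upwards [self_mem_nhdsWithin] with e he
    refine hIge _ (step (P := fun u => max 1 (I - e) ≤ u ∧ u ≤ S + e)
        (Q := fun u => G A b β (S + e) (max 1 (I - e)) ≤ u) hx
        (fun u v hu hv => ?_) (evP e he))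
    have hm1 : 1 ≤ max 1 (I - e) := le_max_left _ _
    have he' : 0 < e := he
    exact (G_mono_v hA hb hβ (by linarith) (by linarith) hv.1).trans
      (G_anti_u hb (by linarith [hu.1]) hu.2 (hFv v (hm1.trans hv.1)))
  have hSI : S = I := no_two hA hb hβ1 hI1 hIS k1 k2
  refine ⟨I, hI1, eqn hb hβ hI1 ?_, tendsto_of_liminf_eq_limsup hI.symm (hS.symm.trans hSI) bd1 bd2⟩
  rw [hSI] at k1 k2
  exact le_antisymm k1 k2

end
end Aux18

/-- Global asymptotic stability of the positive equilibrium when `c·z₊ > 1`: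
if `a > b·β` and `c·z₊ > 1`, every solution with nonnegative initial
conditions, not all zero, converges to `z₊`. -/
theorem stmt18 (a b c : ℝ) (ha : 0 < a) (hb : 0 < b) (hc : 0 < c)
    (τ : ℕ) (hτ : 1 ≤ τ) (hab : b * (1 + b) ^ τ < a)
    (hcz : 1 < c * zplus a b c ((1 + b) ^ τ))
    (z : ℕ → ℝ) (hinit : ∀ i, i < τ → 0 ≤ z i)
    (hnz : ¬ ∀ i, i < τ → z i = 0)
    (hrec : ∀ t, z (t + τ) = Hfun a b c ((1 + b) ^ τ) (z (t + τ - 1)) (z t)) :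
    Filter.Tendsto z Filter.atTop (nhds (zplus a b c ((1 + b) ^ τ))) := by
  set β := (1 + b) ^ τ with hβdef
  have hβ1 : 1 + b ≤ β := by
    have := pow_le_pow_right₀ (by linarith : (1:ℝ) ≤ 1 + b) hτ
    simpa using this
  have hβ' : 0 < β - 1 := by linarith
  set w := c * zplus a b c β with hw
  have hweq : (β - 1) * w ^ 2 + b * (2 * β - 1) * w + b ^ 2 * β = a * b := by
    have hD : 0 ≤ (b * (2 * β - 1)) ^ 2 + 4 * b * (a - b * β) * (β - 1) := by
      have : 0 < a - b * β := by linarith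
      positivity
    have hs := Real.sq_sqrt hD
    have hw2 : 2 * (β - 1) * w + b * (2 * β - 1) =
        Real.sqrt ((b * (2 * β - 1)) ^ 2 + 4 * b * (a - b * β) * (β - 1)) := by
      rw [hw]; unfold zplus
      field_simp
      ring
    rw [← hw2] at hs
    have : 4 * (β - 1) * ((β - 1) * w ^ 2 + b * (2 * β - 1) * w + b ^ 2 * β)
        = 4 * (β - 1) * (a * b) := by linarith
    exact mul_left_cancel₀ (by positivity) this
  have h2β : 0 < b * (2 * β - 1) := mul_pos hb (by linarith)
  have h1 : (β - 1) + b * (2 * β - 1) + b ^ 2 * β < a * b := by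
    have : 1 < w ^ 2 := by nlinarith
    nlinarith
  obtain ⟨L, hL1, hL, hT⟩ := Aux18.core (A := a * b) (b := b) (β := β) (x := fun t => c * z t)
    (mul_pos ha hb) hb hβ1 h1 hτ (fun i hi => mul_nonneg hc.le (hinit i hi))
    (fun h => hnz fun i hi => by simpa [hc.ne'] using h i hi)
    (fun t => by
      simp only [hrec t]
      unfold Hfun Aux18.G Aux18.F
      rw [show (β - 1) * (c * z t) = (β - 1) * c * z t by ring]
      ring)
  have hLw : L = w := by
    have : (L - w) * ((β - 1) * (L + w) + b * (2 * β - 1)) = 0 := by linarith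
    rcases mul_eq_zero.1 this with h | h
    · linarith
    · have : 0 < (β - 1) * (L + w) := mul_pos hβ' (by linarith)
      linarith
  rw [hLw, hw] at hT
  have := hT.const_mul c⁻¹
  simpa [← mul_assoc, inv_mul_cancel₀ hc.ne'] using this
end
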